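/- arXiv:2508.06822 — 5 statements merged into one kernel-verified Lean document; each statement's English description precedes it below -/
import Mathlib

section
/- Let d be a link-graded derivation on A = FreeAlgebra k S with link grading c, r : S → P. Let ≈ be an equivalence relation on P (a partition π of P), and let J_π be the two-sided ideal of A generated by the set of generators x ∈ S with ¬(c(x) ≈ r(x)). Then d maps J_π into J_π. (This is the paper's proposition that for any partition π of P, the ideal J_π generated by all generators whose endpoints lie in different parts is preserved by the differential ∂.) -/
/-!
STATEMENT 0: If `d` is a link-graded derivation on `A = FreeAlgebra k S` with link grading
`c, r : S → P`, and `≈` (here `eqv`) is an equivalence relation on `P`, then the two-sided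
ideal `J_π` of `A` generated by the generators `x` with `¬ eqv (c x) (r x)` is preserved by `d`.
-/

/-- `Composable c r i j l` : the list of generators `l` forms a composable word from `i` to `j`. -/
inductive Composable {S P : Type*} (c r : S → P) : P → P → List S → Prop
  | nil (i : P) : Composable c r i i []
  | cons (x : S) {j : P} {l : List S} :
      Composable c r (r x) j l → Composable c r (c x) j (x :: l)

/-- The product in `FreeAlgebra k S` of the word corresponding to a list of generators. -/
def wordProd (k : Type*) [Field k] {S : Type*} (l : List S) : FreeAlgebra k S :=
  (l.map (FreeAlgebra.ι k)).prod

/-- The `k`-linear span of the composable words from `i` to `j`. -/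
def composableSpan (k : Type*) [Field k] {S P : Type*} (c r : S → P) (i j : P) :
    Submodule k (FreeAlgebra k S) :=
  Submodule.span k {a | ∃ l : List S, Composable c r i j l ∧ a = wordProd k l}

/-- The two-sided ideal of `FreeAlgebra k S` generated by the generators lying in `X ⊆ S`,
realized as the `k`-span of all elements `a * x * b` with `x ∈ X`. -/
def genIdeal (k : Type*) [Field k] {S : Type*} (X : Set S) : Submodule k (FreeAlgebra k S) :=
  Submodule.span k
    {y | ∃ (a b : FreeAlgebra k S) (x : S), x ∈ X ∧ y = a * FreeAlgebra.ι k x * b}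

theorem Composable.exists_not_eqv {S P : Type*} {c r : S → P} {eqv : P → P → Prop}
    (heqv : Equivalence eqv) {i j : P} {l : List S} (h : Composable c r i j l)
    (hij : ¬ eqv i j) : ∃ x ∈ l, ¬ eqv (c x) (r x) := by
  induction h with
  | nil i => exact absurd (heqv.refl i) hij
  | cons x _ ih =>
    by_cases hx : eqv (c x) (r x)
    · obtain ⟨y, hy, hy'⟩ := ih fun h => hij (heqv.trans hx h)
      exact ⟨y, List.mem_cons_of_mem _ hy, hy'⟩
    · exact ⟨x, List.mem_cons_self, hx⟩

theorem mul_mul_mem_genIdeal {k S : Type*} [Field k] {X : Set S} {y : FreeAlgebra k S}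
    (hy : y ∈ genIdeal k X) (a b : FreeAlgebra k S) : a * y * b ∈ genIdeal k X := by
  induction hy using Submodule.span_induction with
  | mem y h =>
    obtain ⟨a', b', x, hx, rfl⟩ := h
    exact Submodule.subset_span ⟨a * a', b' * b, x, hx, by simp only [mul_assoc]⟩
  | zero => simp
  | add y z _ _ hy hz => simpa only [mul_add, add_mul] using add_mem hy hz
  | smul t y _ hy =>
    simpa only [mul_smul_comm, smul_mul_assoc] using Submodule.smul_mem _ t hy

theorem wordProd_mem_genIdeal {k S : Type*} [Field k] {X : Set S} {l : List S} {x : S}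
    (hl : x ∈ l) (hx : x ∈ X) : wordProd k l ∈ genIdeal k X := by
  obtain ⟨s, t, rfl⟩ := List.append_of_mem hl
  exact Submodule.subset_span
    ⟨wordProd k s, wordProd k t, x, hx, by simp [wordProd, mul_assoc]⟩

theorem composableSpan_le_genIdeal (k : Type*) {S P : Type*} [Field k] (c r : S → P)
    {eqv : P → P → Prop} (heqv : Equivalence eqv) {i j : P} (hij : ¬ eqv i j) :
    composableSpan k c r i j ≤ genIdeal k {x : S | ¬ eqv (c x) (r x)} := by
  refine Submodule.span_le.2 ?_
  rintro _ ⟨l, hl, rfl⟩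
  obtain ⟨x, hxl, hx⟩ := hl.exists_not_eqv heqv hij
  exact wordProd_mem_genIdeal hxl hx

theorem linkGraded_derivation_preserves_partition_ideal
    {k S P : Type*} [Field k] [CharP k 2] (c r : S → P)
    (eqv : P → P → Prop) (heqv : Equivalence eqv)
    (d : FreeAlgebra k S →ₗ[k] FreeAlgebra k S)
    (hLeib : ∀ a b : FreeAlgebra k S, d (a * b) = d a * b + a * d b)
    (hlg : ∀ x : S, d (FreeAlgebra.ι k x) ∈ composableSpan k c r (c x) (r x)) :
    ∀ y ∈ genIdeal k {x : S | ¬ eqv (c x) (r x)},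
      d y ∈ genIdeal k {x : S | ¬ eqv (c x) (r x)} := by
  intro y hy
  induction hy using Submodule.span_induction with
  | mem y h =>
    obtain ⟨a, b, x, hx, rfl⟩ := h
    have hι : FreeAlgebra.ι k x ∈ genIdeal k {x : S | ¬ eqv (c x) (r x)} :=
      Submodule.subset_span ⟨1, 1, x, hx, by simp⟩
    have hdι := composableSpan_le_genIdeal k c r heqv hx (hlg x)
    rw [hLeib, hLeib, add_mul]
    exact add_mem (add_mem (mul_mul_mem_genIdeal hι _ _) (mul_mul_mem_genIdeal hdι _ _))
      (mul_mul_mem_genIdeal hι _ _)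
  | zero => simp
  | add y z _ _ hy hz => simpa only [map_add] using add_mem hy hz
  | smul t y _ hy => simpa only [map_smul] using Submodule.smul_mem _ t hy
end

section
/- Let d be a link-graded derivation on A = FreeAlgebra k S with link grading c, r : S → P, and let I ⊆ P. Let J be the two-sided ideal of A generated by the generators x ∈ S such that exactly one of c(x), r(x) lies in I, and let B_I ⊆ A be the unital subalgebra generated by the generators x with c(x) ∈ I and r(x) ∈ I. Then d(B_I) ⊆ B_I + J; in particular, the image of B_I in the quotient A/J is preserved by the derivation induced by d on A/J. (This is the paper's proposition that for any I ⊆ P, the algebra A_I is preserved by the differential inherited by A_{I⊔Iᶜ}.) -/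
section GenIdeal

variable {k S P : Type*} [Field k]

theorem mul_mem_genIdeal_left {X : Set S} (u : FreeAlgebra k S) {y : FreeAlgebra k S}
    (hy : y ∈ genIdeal k X) : u * y ∈ genIdeal k X := by
  refine (Submodule.span_le (p := (genIdeal k X).comap (LinearMap.mulLeft k u))).2 ?_ hy
  rintro _ ⟨a, b, x, hx, rfl⟩
  exact Submodule.subset_span ⟨u * a, b, x, hx, by simp [mul_assoc]⟩

theorem mul_mem_genIdeal_right {X : Set S} (u : FreeAlgebra k S) {y : FreeAlgebra k S}
    (hy : y ∈ genIdeal k X) : y * u ∈ genIdeal k X := by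
  refine (Submodule.span_le (p := (genIdeal k X).comap (LinearMap.mulRight k u))).2 ?_ hy
  rintro _ ⟨a, b, x, hx, rfl⟩
  exact Submodule.subset_span ⟨a, b * u, x, hx, by simp [mul_assoc]⟩

theorem mul_mem_toSubmodule_sup_genIdeal_left {X : Set S} {B : Subalgebra k (FreeAlgebra k S)}
    {u y : FreeAlgebra k S} (hu : u ∈ B) (hy : y ∈ Subalgebra.toSubmodule B ⊔ genIdeal k X) :
    u * y ∈ Subalgebra.toSubmodule B ⊔ genIdeal k X := by
  obtain ⟨b, hb, j, hj, rfl⟩ := Submodule.mem_sup.1 hy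
  rw [mul_add]
  exact Submodule.add_mem_sup (B.mul_mem hu hb) (mul_mem_genIdeal_left u hj)

theorem mul_mem_toSubmodule_sup_genIdeal_right {X : Set S} {B : Subalgebra k (FreeAlgebra k S)}
    {u y : FreeAlgebra k S} (hu : u ∈ B) (hy : y ∈ Subalgebra.toSubmodule B ⊔ genIdeal k X) :
    y * u ∈ Subalgebra.toSubmodule B ⊔ genIdeal k X := by
  obtain ⟨b, hb, j, hj, rfl⟩ := Submodule.mem_sup.1 hy
  rw [add_mul]
  exact Submodule.add_mem_sup (B.mul_mem hb hu) (mul_mem_genIdeal_right u hj)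

/-- A composable word with both endpoints in `I` either stays among the generators with both
endpoints in `I`, or leaves `I` through a generator with exactly one endpoint in `I`. -/
theorem Composable.wordProd_mem_adjoin_sup_genIdeal {c r : S → P} {I : Set P} {i j : P}
    {l : List S} (h : Composable c r i j l) (hi : i ∈ I) (hj : j ∈ I) :
    wordProd k l ∈ Subalgebra.toSubmodule
        (Algebra.adjoin k (FreeAlgebra.ι k '' {x : S | c x ∈ I ∧ r x ∈ I}))
      ⊔ genIdeal k {x : S | Xor (c x ∈ I) (r x ∈ I)} := by
  induction h with
  | nil i => exact Submodule.mem_sup_left (Subalgebra.one_mem _)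
  | @cons x j l _ ih =>
    have hcons : wordProd k (x :: l) = FreeAlgebra.ι k x * wordProd k l := by simp [wordProd]
    rw [hcons]
    by_cases hr : r x ∈ I
    · exact mul_mem_toSubmodule_sup_genIdeal_left
        (Algebra.subset_adjoin ⟨x, ⟨hi, hr⟩, rfl⟩) (ih hr hj)
    · exact Submodule.mem_sup_right
        (Submodule.subset_span ⟨1, wordProd k l, x, Or.inl ⟨hi, hr⟩, by rw [one_mul]⟩)

end GenIdeal

theorem linkGraded_derivation_preserves_diagonal_subalgebra
    {k S P : Type*} [Field k] [CharP k 2] (c r : S → P) (I : Set P)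
    (d : FreeAlgebra k S →ₗ[k] FreeAlgebra k S)
    (hLeib : ∀ a b : FreeAlgebra k S, d (a * b) = d a * b + a * d b)
    (hlg : ∀ x : S, d (FreeAlgebra.ι k x) ∈ composableSpan k c r (c x) (r x)) :
    ∀ y ∈ Algebra.adjoin k (FreeAlgebra.ι k '' {x : S | c x ∈ I ∧ r x ∈ I}),
      d y ∈ Subalgebra.toSubmodule
              (Algebra.adjoin k (FreeAlgebra.ι k '' {x : S | c x ∈ I ∧ r x ∈ I}))
            ⊔ genIdeal k {x : S | Xor' (c x ∈ I) (r x ∈ I)} := by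
  have hd_one : d 1 = 0 := by simpa using hLeib 1 1
  intro y hy
  induction hy using Algebra.adjoin_induction with
  | mem y hy =>
    obtain ⟨x, ⟨hc, hr⟩, rfl⟩ := hy
    refine Submodule.span_le.2 ?_ (hlg x)
    rintro _ ⟨l, hl, rfl⟩
    exact hl.wordProd_mem_adjoin_sup_genIdeal hc hr
  | algebraMap t =>
    rw [Algebra.algebraMap_eq_smul_one, map_smul, hd_one, smul_zero]
    exact zero_mem _
  | add a b _ _ iha ihb =>
    rw [map_add]
    exact add_mem iha ihb
  | mul a b ha hb iha ihb =>
    rw [hLeib]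
    exact add_mem (mul_mem_toSubmodule_sup_genIdeal_right hb iha)
      (mul_mem_toSubmodule_sup_genIdeal_left ha ihb)
end

section
/- Let d be a derivation on A = FreeAlgebra k S and let ε : A → k be a k-algebra homomorphism with ε ∘ d = 0. Let φ_ε : A → A be the algebra automorphism with φ_ε(x) = x + ε(x)·1 for generators x (an involution since char k = 2), and set d_ε := φ_ε ∘ d ∘ φ_ε. Let A₊ be the two-sided ideal of A generated by S. Then d_ε(A₊) ⊆ A₊ and d_ε(A₊·A₊) ⊆ A₊·A₊; consequently d_ε induces a well-defined k-linear map on the quotient A₊/(A₊·A₊). (This is the paper's claim that the twisted differential ∂_ε preserves the augmentation ideal A^ε₊ and descends to a differential on A^ε₊/(A^ε₊)² ≅ C.) -/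
theorem mul_right_mem_genIdeal {k S : Type*} [Field k] {X : Set S} {y : FreeAlgebra k S}
    (hy : y ∈ genIdeal k X) (c : FreeAlgebra k S) : y * c ∈ genIdeal k X := by
  induction hy using Submodule.span_induction with
  | mem y hy =>
    obtain ⟨a, b, x, hx, rfl⟩ := hy
    exact Submodule.subset_span ⟨a, b * c, x, hx, by simp only [mul_assoc]⟩
  | zero => simp
  | add y z _ _ hy hz => simpa only [add_mul] using add_mem hy hz
  | smul r y _ hy => simpa only [smul_mul_assoc] using Submodule.smul_mem _ r hy

/-- Every element of the free algebra differs from its constant term by an element of the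
augmentation ideal. -/
theorem sub_algebraMapInv_mem_genIdeal {k S : Type*} [Field k] (y : FreeAlgebra k S) :
    y - algebraMap k (FreeAlgebra k S) (FreeAlgebra.algebraMapInv y) ∈
      genIdeal k (Set.univ : Set S) := by
  induction y using FreeAlgebra.induction with
  | grade0 r => simp [FreeAlgebra.algebraMapInv]
  | grade1 x =>
    exact Submodule.subset_span ⟨1, 1, x, Set.mem_univ x, by simp [FreeAlgebra.algebraMapInv]⟩
  | mul a b ha hb =>
    have h := add_mem (mul_right_mem_genIdeal ha b)
      (Submodule.smul_mem _ (FreeAlgebra.algebraMapInv a) hb)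
    convert h using 1
    rw [Algebra.smul_def, map_mul, map_mul, sub_mul, mul_sub]
    abel
  | add a b ha hb =>
    convert add_mem ha hb using 1
    rw [map_add, map_add]
    abel

theorem mem_genIdeal_of_algebraMapInv_eq_zero {k S : Type*} [Field k] {y : FreeAlgebra k S}
    (hy : FreeAlgebra.algebraMapInv y = (0 : k)) : y ∈ genIdeal k (Set.univ : Set S) := by
  simpa [hy] using sub_algebraMapInv_mem_genIdeal y

theorem twisted_differential_preserves_augmentation_ideal
    {k S : Type*} [Field k] [CharP k 2]
    (d : FreeAlgebra k S →ₗ[k] FreeAlgebra k S)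
    (hLeib : ∀ a b : FreeAlgebra k S, d (a * b) = d a * b + a * d b)
    (ε : FreeAlgebra k S →ₐ[k] k) (hεd : ∀ a : FreeAlgebra k S, ε (d a) = 0)
    (φ : FreeAlgebra k S →ₐ[k] FreeAlgebra k S)
    (hφ : ∀ x : S, φ (FreeAlgebra.ι k x) =
      FreeAlgebra.ι k x + algebraMap k (FreeAlgebra k S) (ε (FreeAlgebra.ι k x))) :
    (∀ y ∈ genIdeal k (Set.univ : Set S), φ (d (φ y)) ∈ genIdeal k (Set.univ : Set S)) ∧
    (∀ y ∈ genIdeal k (Set.univ : Set S) * genIdeal k (Set.univ : Set S),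
      φ (d (φ y)) ∈ genIdeal k (Set.univ : Set S) * genIdeal k (Set.univ : Set S)) := by
  have hφφ (a : FreeAlgebra k S) : φ (φ a) = a := by
    have h : φ.comp φ = AlgHom.id k (FreeAlgebra k S) := by
      ext x
      simp only [Function.comp_apply, AlgHom.comp_apply, AlgHom.id_apply, hφ, map_add,
        AlgHom.commutes, add_assoc]
      rw [← map_add, CharTwo.add_self_eq_zero, map_zero, add_zero]
    exact DFunLike.congr_fun h a
  have hεφ (a : FreeAlgebra k S) : FreeAlgebra.algebraMapInv (φ a) = ε a := by
    have h : FreeAlgebra.algebraMapInv.comp φ = ε := by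
      ext x
      simp [hφ, FreeAlgebra.algebraMapInv]
    exact DFunLike.congr_fun h a
  have hmem (a : FreeAlgebra k S) : φ (d a) ∈ genIdeal k (Set.univ : Set S) :=
    mem_genIdeal_of_algebraMapInv_eq_zero (by rw [hεφ, hεd])
  refine ⟨fun y _ => hmem (φ y), fun y hy => ?_⟩
  induction hy using Submodule.mul_induction_on' with
  | mem_mul_mem a ha b hb =>
    rw [map_mul, hLeib, map_add, map_mul, map_mul, hφφ, hφφ]
    exact add_mem (Submodule.mul_mem_mul (hmem _) hb) (Submodule.mul_mem_mul ha (hmem _))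
  | add a _ b _ ha hb =>
    simpa only [map_add] using add_mem ha hb
end

section
/- Let A = FreeAlgebra k S carry a link grading c, r : S → P, and let ε : A → k be a k-algebra homomorphism with ε(x) = 0 for every generator x with c(x) ≠ r(x) (i.e., ε respects the link grading). Then for all i, j ∈ P, the automorphism φ_ε maps the k-linear span of the words composable from i to j into itself. -/
theorem ι_mul_mem_composableSpan {k S P : Type*} [Field k] (c r : S → P) (x : S) {j : P}
    {a : FreeAlgebra k S} (ha : a ∈ composableSpan k c r (r x) j) :
    FreeAlgebra.ι k x * a ∈ composableSpan k c r (c x) j := by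
  refine Submodule.span_induction ?_ ?_ ?_ ?_ ha
  · rintro _ ⟨l, hl, rfl⟩
    exact Submodule.subset_span ⟨x :: l, hl.cons x, by simp [wordProd]⟩
  · simp
  · intro a b _ _ ha hb
    rw [mul_add]
    exact add_mem ha hb
  · intro t a _ ha
    rw [mul_smul_comm]
    exact Submodule.smul_mem _ t ha

theorem phi_epsilon_preserves_composable_span
    {k S P : Type*} [Field k] [CharP k 2] (c r : S → P)
    (ε : FreeAlgebra k S →ₐ[k] k)
    (hε : ∀ x : S, c x ≠ r x → ε (FreeAlgebra.ι k x) = 0)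
    (φ : FreeAlgebra k S →ₐ[k] FreeAlgebra k S)
    (hφ : ∀ x : S, φ (FreeAlgebra.ι k x) =
      FreeAlgebra.ι k x + algebraMap k (FreeAlgebra k S) (ε (FreeAlgebra.ι k x))) :
    ∀ i j : P, ∀ a ∈ composableSpan k c r i j, φ a ∈ composableSpan k c r i j := by
  have map_word : ∀ {i j : P} {l : List S}, Composable c r i j l →
      φ (wordProd k l) ∈ composableSpan k c r i j := by
    intro i j l h
    induction h with
    | nil i => exact Submodule.subset_span ⟨[], .nil i, by simp [wordProd]⟩
    | cons x _ ih =>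
      rename_i j l _
      have hcons : wordProd k (x :: l) = FreeAlgebra.ι k x * wordProd k l := by simp [wordProd]
      rw [hcons, map_mul, hφ, add_mul, ← Algebra.smul_def]
      refine add_mem (ι_mul_mem_composableSpan c r x ih) ?_
      by_cases hx : c x = r x
      · rw [hx]
        exact Submodule.smul_mem _ _ ih
      · rw [hε x hx, zero_smul]
        exact zero_mem _
  intro i j
  change composableSpan k c r i j ≤ (composableSpan k c r i j).comap φ.toLinearMap
  refine Submodule.span_le.mpr ?_
  rintro _ ⟨l, hl, rfl⟩
  exact map_word hl
end

section
/- Let C be a category, and let C'' be the category whose objects are pairs (i, X) with i ∈ ℕ and X an object of C, with Hom_{C''}((i, X), (j, Y)) = Hom_C(X, Y) if i < j, only the identity if (i, X) = (j, Y), and no morphisms otherwise, composition being induced from C. Let W be the class of morphisms (i, X) → (i+1, X) corresponding to id_X. Then W admits a left calculus of fractions in C'': W contains the identities (after saturating appropriately, W is closed under the required operations in the sense that) for every f : (i, X) → (j, Y) in C'' and every w : (i, X) → (i+1, X) in W there exist g and a composite of morphisms of W completing a commutative square, and whenever two parallel morphisms are equalized by precomposition with a morphism of W they are already equal after postcomposition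 with a composite of morphisms of W. -/
/-!
STATEMENT 10: In the category `C''` (objects `(i, X)` with `i : ℕ`, `X : C`; morphisms
`Hom(X,Y)` if `i < j`, only the identity if `(i,X) = (j,Y)`, nothing otherwise), the class
`W` of morphisms `(i, X) ⟶ (i+1, X)` corresponding to `id_X` admits a left calculus of
fractions, with "finite composites of elements of `W`" encoded by the class `Wstar`
(identity-like morphisms that raise the index): the saturation `Wstar` contains all
identities, every `f : A ⟶ B` and `w : A ⟶ A'` in `W` fit into a commutative square
`w ≫ g = f ≫ w'` with `w' ∈ Wstar`, and parallel morphisms equalized by precomposition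
with an element of `W` become equal after postcomposition with an element of `Wstar`.
-/

open CategoryTheory

universe v u

/-- Objects of the auxiliary category `C''`: pairs `(i, X)` with `i : ℕ` and `X : C`. -/
structure IndexedObj (C : Type u) : Type u where
  idx : ℕ
  obj : C

variable {C : Type u} [Category.{v} C]

/-- Morphisms `(i, X) ⟶ (j, Y)`: a morphism `X ⟶ Y` of `C` if `i < j`, only the identity
(encoded by the equality of the two objects) if `(i, X) = (j, Y)`, and nothing otherwise. -/
def IndexedHom (A B : IndexedObj C) : Type v :=
  {f : A.obj ⟶ B.obj // A.idx < B.idx} ⊕ ULift.{v} (PLift (A = B))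

/-- Composition in `C''`, induced by composition in `C`. -/
def IndexedHom.comp {A B D : IndexedObj C} (f : IndexedHom A B) (g : IndexedHom B D) :
    IndexedHom A D :=
  match f with
  | Sum.inr ⟨⟨h⟩⟩ => h ▸ g
  | Sum.inl ⟨f, hf⟩ =>
    match g with
    | Sum.inr ⟨⟨h⟩⟩ => h ▸ (Sum.inl ⟨f, hf⟩ : IndexedHom A B)
    | Sum.inl ⟨g, hg⟩ => Sum.inl ⟨f ≫ g, hf.trans hg⟩

instance : Category (IndexedObj C) where
  Hom := IndexedHom
  id A := Sum.inr ⟨⟨rfl⟩⟩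
  comp f g := f.comp g
  id_comp := by
    intro A B f
    rfl
  comp_id := by
    intro A B f
    cases f with
    | inl f => rfl
    | inr h => obtain ⟨⟨h⟩⟩ := h; subst h; rfl
  assoc := by
    intro A B D E f g h
    cases f with
    | inr hf => obtain ⟨⟨hf⟩⟩ := hf; subst hf; rfl
    | inl f =>
      obtain ⟨f, hf⟩ := f
      cases g with
      | inr hg => obtain ⟨⟨hg⟩⟩ := hg; subst hg; rfl
      | inl g =>
        obtain ⟨g, hg⟩ := g
        cases h with
        | inr hh => obtain ⟨⟨hh⟩⟩ := hh; subst hh; rfl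
        | inl h => obtain ⟨h, hh⟩ := h; exact congrArg Sum.inl (by simp)

/-- The class `W` of morphisms `(i, X) ⟶ (i + 1, X)` corresponding to `id_X`. -/
def identityShifts (C : Type u) [Category.{v} C] : MorphismProperty (IndexedObj C) :=
  fun A B f => ∃ (e : A.obj = B.obj) (h : B.idx = A.idx + 1),
    f = Sum.inl ⟨eqToHom e, by omega⟩

/-- The saturation of `W` under finite composition: identity-like morphisms which do not
decrease the index.  A finite composite of elements of `W` is exactly such a morphism. -/
def identityShiftsStar (C : Type u) [Category.{v} C] : MorphismProperty (IndexedObj C) :=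
  fun A B f =>
    (∃ (e : A.obj = B.obj) (h : A.idx < B.idx), f = Sum.inl ⟨eqToHom e, h⟩) ∨
    (∃ e : A = B, f = Sum.inr ⟨⟨e⟩⟩)

/-- The morphism of `C''` given by a morphism of `C` between objects of increasing index. -/
def IndexedHom.ofLT {A B : IndexedObj C} (f : A.obj ⟶ B.obj) (h : A.idx < B.idx) : A ⟶ B :=
  (Sum.inl ⟨f, h⟩ : IndexedHom A B)

theorem IndexedHom.ofLT_comp {A B D : IndexedObj C} (f : A.obj ⟶ B.obj) (hf : A.idx < B.idx)
    (g : B.obj ⟶ D.obj) (hg : B.idx < D.idx) :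
    ofLT f hf ≫ ofLT g hg = ofLT (f ≫ g) (hf.trans hg) :=
  rfl

theorem IndexedHom.ofLT_injective {A B : IndexedObj C} {f g : A.obj ⟶ B.obj}
    {hf hg : A.idx < B.idx} (h : ofLT f hf = ofLT g hg) : f = g :=
  congrArg Subtype.val (Sum.inl_injective h)

theorem IndexedHom.eq_ofLT_or_eq_eqToHom {A B : IndexedObj C} (f : A ⟶ B) :
    (∃ (f' : A.obj ⟶ B.obj) (h : A.idx < B.idx), f = ofLT f' h) ∨
      ∃ h : A = B, f = eqToHom h := by
  rcases (f : IndexedHom A B) with ⟨f', h⟩ | ⟨⟨⟨h⟩⟩⟩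
  · exact Or.inl ⟨f', h, rfl⟩
  · cases h
    exact Or.inr ⟨rfl, rfl⟩

theorem identityShiftsStar_id (A : IndexedObj C) : identityShiftsStar C (𝟙 A) :=
  Or.inr ⟨rfl, rfl⟩

theorem identityShifts_le_identityShiftsStar : identityShifts C ≤ identityShiftsStar C := by
  rintro A B _ ⟨e, h, rfl⟩
  exact Or.inl ⟨e, by omega, rfl⟩

theorem identityShifts_hasLeftCalculusOfFractions (C : Type u) [Category.{v} C] :
    (∀ A : IndexedObj C, identityShiftsStar C (𝟙 A)) ∧
    (∀ (A B A' : IndexedObj C) (f : A ⟶ B) (w : A ⟶ A'), identityShifts C w →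
      ∃ (B' : IndexedObj C) (g : A' ⟶ B') (w' : B ⟶ B'),
        identityShiftsStar C w' ∧ w ≫ g = f ≫ w') ∧
    (∀ (A B A' : IndexedObj C) (w : A' ⟶ A), identityShifts C w →
      ∀ (f g : A ⟶ B), w ≫ f = w ≫ g →
        ∃ (B' : IndexedObj C) (w' : B ⟶ B'),
          identityShiftsStar C w' ∧ f ≫ w' = g ≫ w') := by
  refine ⟨identityShiftsStar_id, ?_, ?_⟩
  · intro A B A' f w hw
    obtain ⟨f', hf, rfl⟩ | ⟨rfl, rfl⟩ := IndexedHom.eq_ofLT_or_eq_eqToHom f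
    · obtain ⟨e, h, rfl⟩ := hw
      refine ⟨⟨B.idx + 1, B.obj⟩,
        IndexedHom.ofLT (eqToHom e.symm ≫ f') (show A'.idx < B.idx + 1 by omega),
        IndexedHom.ofLT (eqToHom rfl) (Nat.lt_succ_self B.idx),
        Or.inl ⟨rfl, Nat.lt_succ_self _, rfl⟩, ?_⟩
      change IndexedHom.ofLT (eqToHom e) _ ≫ _ = _
      simp only [IndexedHom.ofLT_comp]
      congr 1
      simp
    · exact ⟨A', 𝟙 A', w, identityShifts_le_identityShiftsStar w hw, by simp⟩
  · intro A B A' w hw f g hfg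
    refine ⟨B, 𝟙 B, identityShiftsStar_id B, congrArg (· ≫ 𝟙 B) ?_⟩
    obtain ⟨f', hf, rfl⟩ | ⟨hf, rfl⟩ := IndexedHom.eq_ofLT_or_eq_eqToHom f <;>
      obtain ⟨g', hg, rfl⟩ | ⟨hg, rfl⟩ := IndexedHom.eq_ofLT_or_eq_eqToHom g
    · obtain ⟨e, h, rfl⟩ := hw
      have key : eqToHom e ≫ f' = eqToHom e ≫ g' := IndexedHom.ofLT_injective hfg
      rw [(cancel_epi _).mp key]
    · exact absurd hf (hg ▸ lt_irrefl _)
    · exact absurd hg (hf ▸ lt_irrefl _)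
    · rfl
end
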